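/- Let 𝓜⁽¹⁾ and 𝓜⁽²⁾ be two RMMDPs over the same 𝒮, 𝒜, 𝒵 and horizon H, with the same transition kernel T and initial distribution ν, each with M latent contexts, and set d := min(2M − 1, H). Let n(·) assign a nonnegative count to every state–action sequence of length at most d, and let n_l > 0. Define X_l := { x : n(x) ≥ n_l }, E_l := { x_{1:H} : every (not necessarily contiguous) subsequence of x_{1:H} of length at most d lies in X_l }, and δ_l := max over length-d sequences x ∈ X_l, z ∈ 𝒵^d, and I ⊆ {1,…,d} of |𝐌⁽¹⁾(x_I, z_I) − 𝐌⁽²⁾(x_I, z_I)|. Then for every subset E′ ⊆ E_l and every history-dependent policy π: Σ_{τ : x_{1:H} ∈ E′} |P⁽¹⁾_π(τ) − P⁽²⁾_π(τ)| ≤ (sup_{π'} P⁽¹⁾_{π'}(x_{1:H} ∈ E′)) · (4HZ)^{min(2M−1,H)} · δ_l. -/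

import Mathlib

open Finset

/-- A probability distribution on a finite type. -/
def IsDist {X : Type*} [Fintype X] (p : X → ℝ) : Prop :=
  (∀ x, 0 ≤ p x) ∧ ∑ x, p x = 1

/-- A history-dependent policy: each history (past state-action-reward triples together
with the current state) is assigned a probability distribution over actions. -/
def IsPolicy {S A Z : Type*} [Fintype A]
    (π : List ((S × A) × Z) → S → A → ℝ) : Prop :=
  ∀ hist s, (∀ a, 0 ≤ π hist s a) ∧ ∑ a, π hist s a = 1

/-- A latent reward model: for each context and state-action pair, a distribution on rewards. -/
def IsRewardModel {X Z : Type*} [Fintype Z] {M : ℕ}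
    (μ : Fin M → X → Z → ℝ) : Prop :=
  ∀ m x, (∀ z, 0 ≤ μ m x z) ∧ ∑ z, μ m x z = 1

/-- The mixture moment `𝐌(x_I, z_I) = Σ_m w_m Π_{i ∈ I} μ_m(x_i, z_i)`. -/
def momentOn {X Z : Type*} {M d : ℕ} (w : Fin M → ℝ) (μ : Fin M → X → Z → ℝ)
    (x : Fin d → X) (z : Fin d → Z) (I : Finset (Fin d)) : ℝ :=
  ∑ m, w m * ∏ i ∈ I, μ m (x i) (z i)

/-- Probability of a length-`H` trajectory `τ = ((s_t,a_t),r_t)_{t}` under a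
history-dependent policy `π` in an RMMDP with transitions `T`, initial distribution `ν`,
mixing weights `w` and reward models `μ`. -/
noncomputable def trajProb {S A Z : Type*} (H : ℕ)
    (T : S × A → S → ℝ) (ν : S → ℝ)
    (π : List ((S × A) × Z) → S → A → ℝ)
    {M : ℕ} (w : Fin M → ℝ) (μ : Fin M → S × A → Z → ℝ)
    (τ : Fin H → (S × A) × Z) : ℝ :=
  (if h : 0 < H then ν ((τ ⟨0, h⟩).1.1) else 1)
    * (∏ t : Fin H, if h : (t : ℕ) + 1 < H then T (τ t).1 ((τ ⟨(t : ℕ) + 1, h⟩).1.1) else 1)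
    * (∏ t : Fin H, π ((List.ofFn τ).take t.val) (τ t).1.1 (τ t).1.2)
    * momentOn w μ (fun t => (τ t).1) (fun t => (τ t).2) Finset.univ

/-- `P_π(x_{1:H} ∈ E)`: total probability of trajectories whose state-action part lies in `E`. -/
noncomputable def eventProb {S A Z : Type*} [Fintype S] [Fintype A] [Fintype Z]
    [DecidableEq S] [DecidableEq A] (H : ℕ)
    (T : S × A → S → ℝ) (ν : S → ℝ)
    (π : List ((S × A) × Z) → S → A → ℝ)
    {M : ℕ} (w : Fin M → ℝ) (μ : Fin M → S × A → Z → ℝ)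
    (E : Finset (Fin H → S × A)) : ℝ :=
  ∑ τ : Fin H → (S × A) × Z,
    if (fun t => (τ t).1) ∈ E then trajProb H T ν π w μ τ else 0

/-- `sup_π P_π(x_{1:H} ∈ E)`, supremum over all history-dependent policies. -/
noncomputable def supEventProb {S A Z : Type*} [Fintype S] [Fintype A] [Fintype Z]
    [DecidableEq S] [DecidableEq A] (H : ℕ)
    (T : S × A → S → ℝ) (ν : S → ℝ)
    {M : ℕ} (w : Fin M → ℝ) (μ : Fin M → S × A → Z → ℝ)
    (E : Finset (Fin H → S × A)) : ℝ :=
  ⨆ π : {p : List ((S × A) × Z) → S → A → ℝ // IsPolicy p},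
    eventProb H T ν π.1 w μ E

/-- The signed mixture `∑ c · ∏ f(x, z)` of product functions evaluated along a list. -/
def signedMoment {X Z : Type*} (C : List (ℝ × (X → Z → ℝ))) (l : List (X × Z)) : ℝ :=
  (C.map fun c => c.1 * (l.map fun p => c.2 p.1 p.2).prod).sum

/-- The majorant of a signed mixture with components `fs` whose low-order moments are at
most one in absolute value, obtained by eliminating one component at a time. -/
def mixtureMajorant {X Z : Type*} :
    List (X → Z → ℝ) → List (X × Z) → ℝ
  | [], _ => 0
  | _ :: _, [] => 1
  | f :: fs, p :: l => f p.1 p.2 * mixtureMajorant (f :: fs) l + 2 * mixtureMajorant fs l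

/-- The total mass of `mixtureMajorant` for `k` components on `n` coordinates, where
`y` is twice the number of outcomes. -/
def majorantMass (y : ℝ) : ℕ → ℕ → ℝ
  | 0, _ => 0
  | _ + 1, 0 => 1
  | k + 1, n + 1 => majorantMass y (k + 1) n + y * majorantMass y k n

lemma majorantMass_le (y : ℝ) (hy : 1 ≤ y) (n k : ℕ) :
    majorantMass y (k + 1) n ≤ (2 * n * y) ^ (min k n) := by
  induction n generalizing k with
  | zero => simp [majorantMass]
  | succ n ih =>
    rw [majorantMass]
    have hn : (0 : ℝ) ≤ n := n.cast_nonneg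
    have h₁ := ih k
    rcases k with _ | k
    · simpa [majorantMass] using h₁
    have h₂ := ih k
    have h₃ : y * majorantMass y (k + 1) n ≤ y * (2 * n * y) ^ (min k n) := by gcongr
    refine (add_le_add h₁ h₃).trans ?_
    have hmono (j : ℕ) : (2 * n * y) ^ j ≤ (2 * ((n + 1 : ℕ) : ℝ) * y) ^ j := by
      push_cast
      gcongr
      linarith
    rcases le_or_gt (k + 1) n with hk | hk
    · rw [min_eq_left hk, min_eq_left (by omega), min_eq_left (by omega), pow_succ, pow_succ]
      have := hmono k
      have hfac : 2 * n * y + y ≤ 2 * ((n + 1 : ℕ) : ℝ) * y := by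
        push_cast
        nlinarith
      calc (2 * n * y) ^ k * (2 * n * y) + y * (2 * n * y) ^ k
          = (2 * n * y) ^ k * (2 * n * y + y) := by ring
        _ ≤ _ := by gcongr
    · rw [min_eq_right (by omega), min_eq_right (by omega), min_eq_right (by omega), pow_succ]
      have := hmono n
      have hfac : 1 + y ≤ 2 * ((n + 1 : ℕ) : ℝ) * y := by
        push_cast
        nlinarith
      calc (2 * n * y) ^ n + y * (2 * n * y) ^ n
          = (2 * n * y) ^ n * (1 + y) := by ring
        _ ≤ _ := by gcongr

/-- Splitting off one coordinate and eliminating the first component. -/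
lemma signedMoment_cons_sub {X Z : Type*} (c : ℝ) (f : X → Z → ℝ)
    (C : List (ℝ × (X → Z → ℝ))) (p : X × Z) (l : List (X × Z)) :
    signedMoment (C.map fun e => (e.1 * (e.2 p.1 p.2 - f p.1 p.2), e.2)) l
      = signedMoment ((c, f) :: C) (p :: l) - f p.1 p.2 * signedMoment ((c, f) :: C) l := by
  induction C with
  | nil => simp [signedMoment]; ring
  | cons e C ih =>
    simp only [signedMoment, List.map_cons, List.sum_cons, List.prod_cons] at ih ⊢
    rw [ih]
    ring

lemma abs_signedMoment_le {X Z : Type*} (l : List (X × Z))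
    (C : List (ℝ × (X → Z → ℝ)))
    (hC : ∀ e ∈ C, ∀ x z, 0 ≤ e.2 x z ∧ e.2 x z ≤ 1) (δ : ℝ)
    (hδ : ∀ l' : List (X × Z), l'.Sublist l → l'.length < C.length →
      |signedMoment C l'| ≤ δ) :
    |signedMoment C l| ≤ δ * mixtureMajorant (C.map Prod.snd) l := by
  induction l generalizing C δ with
  | nil =>
    rcases C with _ | ⟨e, C⟩
    · simp [signedMoment, mixtureMajorant]
    · simpa [mixtureMajorant] using hδ [] (List.Sublist.refl _) (by simp)
  | cons p l ih =>
    rcases C with _ | ⟨⟨c, f⟩, C⟩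
    · simp [signedMoment, mixtureMajorant]
    obtain ⟨hf₀, hf₁⟩ := hC (c, f) (by simp) p.1 p.2
    have hcoord := ih ((c, f) :: C) hC δ fun l' hl' hlen => hδ l' (hl'.cons p) hlen
    have hrest := ih (C.map fun e => (e.1 * (e.2 p.1 p.2 - f p.1 p.2), e.2))
      (by
        intro e he
        obtain ⟨e', he', rfl⟩ := List.mem_map.1 he
        exact hC e' (List.mem_cons_of_mem _ he'))
      (2 * δ)
      (by
        intro l' hl' hlen
        rw [List.length_map] at hlen
        rw [signedMoment_cons_sub c]
        have h₁ := hδ (p :: l') (hl'.cons_cons p) (by simpa using hlen)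
        have h₂ := hδ l' (hl'.cons p) (by simp; omega)
        have h₃ : |f p.1 p.2 * signedMoment ((c, f) :: C) l'| ≤ δ := by
          rw [abs_mul, abs_of_nonneg hf₀]
          exact (mul_le_of_le_one_left (abs_nonneg _) hf₁).trans h₂
        linarith [abs_sub (signedMoment ((c, f) :: C) (p :: l'))
          (f p.1 p.2 * signedMoment ((c, f) :: C) l')])
    rw [signedMoment_cons_sub c, List.map_map] at hrest
    have hsnd : (Prod.snd ∘ fun e : ℝ × (X → Z → ℝ) =>
        (e.1 * (e.2 p.1 p.2 - f p.1 p.2), e.2)) = Prod.snd := rfl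
    rw [hsnd] at hrest
    simp only [List.map_cons, mixtureMajorant] at hcoord ⊢
    have htri := abs_add_le (signedMoment ((c, f) :: C) (p :: l)
      - f p.1 p.2 * signedMoment ((c, f) :: C) l) (f p.1 p.2 * signedMoment ((c, f) :: C) l)
    rw [sub_add_cancel, abs_mul, abs_of_nonneg hf₀] at htri
    have := mul_le_mul_of_nonneg_left hcoord hf₀
    linarith

/-- Averaging over outcomes is dominated by the best outcome function. -/
lemma sum_kernel_mul_le {X Z : Type*} [Fintype X] [Fintype Z] [Nonempty Z]
    (g L : X → Z → ℝ) (m C : ℝ) (hm : 0 ≤ m) (hg : ∀ x z, 0 ≤ g x z)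
    (hgm : ∀ x, ∑ z, g x z = m) (hL : ∀ r : X → Z, ∑ x, L x (r x) ≤ C) :
    ∑ x, ∑ z, g x z * L x z ≤ m * C := by
  have hmax (x : X) : ∃ z, ∀ z', L x z' ≤ L x z := by
    simpa using Finset.exists_max_image Finset.univ (L x) Finset.univ_nonempty
  choose r hr using hmax
  calc ∑ x, ∑ z, g x z * L x z
      ≤ ∑ x, ∑ z, g x z * L x (r x) := by
        gcongr with x _ z _
        · exact hg x z
        · exact hr x z
    _ = m * ∑ x, L x (r x) := by
        rw [Finset.mul_sum]
        exact Finset.sum_congr rfl fun x _ => by rw [← Finset.sum_mul, hgm]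
    _ ≤ m * C := by gcongr; exact hL r

lemma sum_fin_succ_pi {α : Type*} [Fintype α] (n : ℕ) (F : (Fin (n + 1) → α) → ℝ) :
    ∑ τ, F τ = ∑ p : α, ∑ τ : Fin n → α, F (Fin.cons p τ) := by
  rw [← Fintype.sum_prod_type']
  exact (Fintype.sum_equiv (Fin.consEquiv fun _ => α) _ _ fun _ => rfl).symm

lemma sum_mul_mixtureMajorant_le {X Z : Type*} [Fintype X] [Fintype Z] [Nonempty Z]
    (n : ℕ) (fs : List (X → Z → ℝ))
    (hfs : ∀ f ∈ fs, ∀ x, (∀ z, 0 ≤ f x z) ∧ ∑ z, f x z = 1)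
    (K : (Fin n → X × Z) → ℝ) (C : ℝ)
    (hK : ∀ r : Fin n → X → Z, ∑ x : Fin n → X, K (fun t => (x t, r t (x t))) ≤ C) :
    ∑ τ, K τ * mixtureMajorant fs (List.ofFn τ)
      ≤ majorantMass (2 * Fintype.card Z) fs.length n * C := by
  induction n generalizing fs C with
  | zero =>
    rcases fs with _ | ⟨f, fs⟩
    · simp [mixtureMajorant, majorantMass]
    · have := hK Fin.elim0
      rw [Fintype.sum_unique] at this ⊢
      simp only [List.ofFn_zero, mixtureMajorant, majorantMass, List.length_cons, mul_one, one_mul]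
      convert this
  | succ n ih =>
    rcases fs with _ | ⟨f, fs⟩
    · simp [mixtureMajorant, majorantMass]
    have key (g : X → Z → ℝ) (m : ℝ) (hm : 0 ≤ m) (hg : ∀ x z, 0 ≤ g x z)
        (hgm : ∀ x, ∑ z, g x z = m) (r : Fin n → X → Z) :
        ∑ x : Fin n → X, ∑ p : X × Z, g p.1 p.2 *
          K (Fin.cons p fun t => (x t, r t (x t))) ≤ m * C := by
      rw [Finset.sum_comm, Fintype.sum_prod_type]
      simp only [← Finset.mul_sum]
      refine sum_kernel_mul_le g _ m C hm hg hgm fun r₀ => ?_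
      have := hK (Fin.cons r₀ r)
      rw [sum_fin_succ_pi] at this
      refine le_trans (le_of_eq ?_) this
      refine Finset.sum_congr rfl fun x₀ _ => Finset.sum_congr rfl fun x _ => ?_
      congr 1
      funext t
      refine Fin.cases ?_ (fun i => ?_) t <;> simp
    have hf := hfs f (by simp)
    have h₁ := ih (f :: fs) hfs (fun τ => ∑ p : X × Z, f p.1 p.2 * K (Fin.cons p τ)) (1 * C)
      (key f 1 zero_le_one (fun x => (hf x).1) fun x => (hf x).2)
    have h₂ := ih fs (fun f' h' => hfs f' (List.mem_cons_of_mem _ h'))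
      (fun τ => ∑ p : X × Z, 1 * K (Fin.cons p τ)) (Fintype.card Z * C)
      (key (fun _ _ => 1) (Fintype.card Z) (Nat.cast_nonneg _) (fun _ _ => zero_le_one)
        fun x => by simp)
    have hsplit : ∑ τ, K τ * mixtureMajorant (f :: fs) (List.ofFn τ)
        = ∑ τ : Fin n → X × Z, (∑ p : X × Z, f p.1 p.2 * K (Fin.cons p τ))
            * mixtureMajorant (f :: fs) (List.ofFn τ)
          + 2 * ∑ τ : Fin n → X × Z, (∑ p : X × Z, 1 * K (Fin.cons p τ))
            * mixtureMajorant fs (List.ofFn τ) := by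
      rw [sum_fin_succ_pi, Finset.sum_comm, Finset.mul_sum, ← Finset.sum_add_distrib]
      refine Finset.sum_congr rfl fun τ _ => ?_
      rw [Finset.sum_mul, Finset.sum_mul, Finset.mul_sum, ← Finset.sum_add_distrib]
      refine Finset.sum_congr rfl fun p _ => ?_
      rw [List.ofFn_cons, mixtureMajorant]
      ring
    rw [hsplit, List.length_cons, majorantMass]
    rw [List.length_cons] at h₁
    linarith

lemma exists_sublist_between {α : Type*} {l' l : List α} (h : l'.Sublist l) (d : ℕ)
    (h₁ : l'.length ≤ d) (h₂ : d ≤ l.length) :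
    ∃ l'' : List α, l'.Sublist l'' ∧ l''.Sublist l ∧ l''.length = d := by
  induction h generalizing d with
  | slnil => exact ⟨[], by simp, by simp, by simpa [eq_comm] using h₂⟩
  | @cons l' l a h ih =>
    rcases h₂.eq_or_lt with rfl | hlt
    · exact ⟨a :: l, h.cons a, List.Sublist.refl _, rfl⟩
    · obtain ⟨l'', hl, hr, hlen⟩ := ih d h₁ (by simpa [Nat.lt_succ_iff] using hlt)
      exact ⟨l'', hl, hr.cons a, hlen⟩
  | @cons_cons l' l a h ih =>
    rcases d with _ | d
    · simp at h₁
    · obtain ⟨l'', hl, hr, hlen⟩ := ih d (by simpa using h₁) (by simpa using h₂)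
      exact ⟨a :: l'', hl.cons_cons a, hr.cons_cons a, by simp [hlen]⟩

lemma exists_finset_prod_of_sublist {α : Type*} {d : ℕ} {l : List α} {y : Fin d → α}
    (h : l.Sublist (List.ofFn y)) :
    ∃ I : Finset (Fin d), ∀ f : α → ℝ, (l.map f).prod = ∏ i ∈ I, f (y i) := by
  obtain ⟨e, he⟩ := List.sublist_iff_exists_fin_orderEmbedding_get_eq.1 h
  refine ⟨Finset.univ.map (e.toEmbedding.trans (finCongr (List.length_ofFn)).toEmbedding),
    fun f => ?_⟩
  rw [Finset.prod_map, ← List.ofFn_get (l.map f), List.prod_ofFn]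
  refine Fintype.prod_equiv (finCongr (by simp)) _ _ fun i => ?_
  have := he (Fin.cast (by simp) i)
  simp only [List.get_eq_getElem, List.getElem_ofFn] at this
  simp only [List.get_eq_getElem, List.getElem_map]
  exact congrArg f this

/-- The components of the difference of two mixtures. -/
def differenceComponents {X Z : Type*} {M : ℕ} (w₁ : Fin M → ℝ) (μ₁ : Fin M → X → Z → ℝ)
    (w₂ : Fin M → ℝ) (μ₂ : Fin M → X → Z → ℝ) : List (ℝ × (X → Z → ℝ)) :=
  (List.ofFn fun m => (w₁ m, μ₁ m)) ++ List.ofFn fun m => (-w₂ m, μ₂ m)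

lemma signedMoment_differenceComponents {X Z : Type*} {M d : ℕ} (w₁ : Fin M → ℝ)
    (μ₁ : Fin M → X → Z → ℝ) (w₂ : Fin M → ℝ) (μ₂ : Fin M → X → Z → ℝ)
    (l : List (X × Z)) (x : Fin d → X) (z : Fin d → Z) (I : Finset (Fin d))
    (h : ∀ f : X × Z → ℝ, (l.map f).prod = ∏ i ∈ I, f (x i, z i)) :
    signedMoment (differenceComponents w₁ μ₁ w₂ μ₂) l
      = momentOn w₁ μ₁ x z I - momentOn w₂ μ₂ x z I := by
  simp [signedMoment, differenceComponents, momentOn, List.map_ofFn, List.sum_ofFn,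
    Function.comp_def, h, sub_eq_add_neg]

lemma mem_differenceComponents {X Z : Type*} [Fintype Z] {M : ℕ} {w₁ : Fin M → ℝ}
    {μ₁ : Fin M → X → Z → ℝ} {w₂ : Fin M → ℝ} {μ₂ : Fin M → X → Z → ℝ}
    (hμ₁ : IsRewardModel μ₁) (hμ₂ : IsRewardModel μ₂) {e : ℝ × (X → Z → ℝ)}
    (he : e ∈ differenceComponents w₁ μ₁ w₂ μ₂) (x : X) :
    (∀ z, 0 ≤ e.2 x z) ∧ ∑ z, e.2 x z = 1 := by
  simp only [differenceComponents, List.mem_append, List.mem_ofFn] at he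
  rcases he with ⟨m, rfl⟩ | ⟨m, rfl⟩
  · exact hμ₁ m x
  · exact hμ₂ m x

lemma le_one_of_sum_eq_one {Z : Type*} [Fintype Z] {p : Z → ℝ} (h₀ : ∀ z, 0 ≤ p z)
    (h₁ : ∑ z, p z = 1) (z : Z) : p z ≤ 1 :=
  h₁ ▸ Finset.single_le_sum (fun i _ => h₀ i) (Finset.mem_univ z)

/-- The transition and policy factor of `trajProb`. -/
noncomputable def pathWeight {S A Z : Type*} (H : ℕ)
    (T : S × A → S → ℝ) (ν : S → ℝ)
    (π : List ((S × A) × Z) → S → A → ℝ)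
    (τ : Fin H → (S × A) × Z) : ℝ :=
  (if h : 0 < H then ν ((τ ⟨0, h⟩).1.1) else 1)
    * (∏ t : Fin H, if h : (t : ℕ) + 1 < H then T (τ t).1 ((τ ⟨(t : ℕ) + 1, h⟩).1.1) else 1)
    * (∏ t : Fin H, π ((List.ofFn τ).take t.val) (τ t).1.1 (τ t).1.2)

lemma trajProb_eq {S A Z : Type*} (H : ℕ) (T : S × A → S → ℝ) (ν : S → ℝ)
    (π : List ((S × A) × Z) → S → A → ℝ) {M : ℕ} (w : Fin M → ℝ)
    (μ : Fin M → S × A → Z → ℝ) (τ : Fin H → (S × A) × Z) :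
    trajProb H T ν π w μ τ = pathWeight H T ν π τ
      * momentOn w μ (fun t => (τ t).1) (fun t => (τ t).2) Finset.univ := rfl

lemma pathWeight_nonneg {S A Z : Type*} [Fintype S] [Fintype A] (H : ℕ)
    {T : S × A → S → ℝ} {ν : S → ℝ} (hT : ∀ x, IsDist (T x)) (hν : IsDist ν)
    {π : List ((S × A) × Z) → S → A → ℝ} (hπ : IsPolicy π) (τ : Fin H → (S × A) × Z) :
    0 ≤ pathWeight H T ν π τ := by
  refine mul_nonneg (mul_nonneg ?_ (Finset.prod_nonneg fun t _ => ?_))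
    (Finset.prod_nonneg fun t _ => (hπ _ _).1 _)
  · split_ifs
    · exact hν.1 _
    · exact zero_le_one
  · split_ifs
    · exact (hT _).1 _
    · exact zero_le_one

lemma pathWeight_le_one {S A Z : Type*} [Fintype S] [Fintype A] (H : ℕ)
    {T : S × A → S → ℝ} {ν : S → ℝ} (hT : ∀ x, IsDist (T x)) (hν : IsDist ν)
    {π : List ((S × A) × Z) → S → A → ℝ} (hπ : IsPolicy π) (τ : Fin H → (S × A) × Z) :
    pathWeight H T ν π τ ≤ 1 := by
  have hT₀ : ∀ t : Fin H, 0 ≤ (if h : (t : ℕ) + 1 < H then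
      T (τ t).1 ((τ ⟨(t : ℕ) + 1, h⟩).1.1) else 1) := fun t => by
    split_ifs
    · exact (hT _).1 _
    · exact zero_le_one
  refine mul_le_one₀ (mul_le_one₀ ?_ (Finset.prod_nonneg fun t _ => hT₀ t)
    (Finset.prod_le_one (fun t _ => hT₀ t) fun t _ => ?_))
    (Finset.prod_nonneg fun t _ => (hπ _ _).1 _)
    (Finset.prod_le_one (fun t _ => (hπ _ _).1 _) fun t _ =>
      le_one_of_sum_eq_one (hπ _ _).1 (hπ _ _).2 _)
  · split_ifs
    · exact le_one_of_sum_eq_one hν.1 hν.2 _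
    · exact le_rfl
  · split_ifs
    · exact le_one_of_sum_eq_one (hT _).1 (hT _).2 _
    · exact le_rfl

lemma sum_momentOn_univ {X Z : Type*} [Fintype Z] {M H : ℕ} {w : Fin M → ℝ}
    {μ : Fin M → X → Z → ℝ} (hw : IsDist w) (hμ : IsRewardModel μ) (x : Fin H → X) :
    ∑ z : Fin H → Z, momentOn w μ x z Finset.univ = 1 := by
  simp only [momentOn]
  rw [Finset.sum_comm, ← hw.2]
  refine Finset.sum_congr rfl fun m _ => ?_
  rw [← Finset.mul_sum, ← Fintype.prod_sum fun t z => μ m (x t) z]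
  simp [(hμ m _).2]

lemma momentOn_nonneg {X Z : Type*} [Fintype Z] {M d : ℕ} {w : Fin M → ℝ}
    {μ : Fin M → X → Z → ℝ} (hw : IsDist w) (hμ : IsRewardModel μ) (x : Fin d → X)
    (z : Fin d → Z) (I : Finset (Fin d)) : 0 ≤ momentOn w μ x z I :=
  Finset.sum_nonneg fun m _ =>
    mul_nonneg (hw.1 m) (Finset.prod_nonneg fun _ _ => (hμ m _).1 _)

lemma sum_traj_eq {X Z : Type*} [Fintype X] [Fintype Z] (H : ℕ)
    (F : (Fin H → X × Z) → ℝ) :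
    ∑ τ, F τ = ∑ x : Fin H → X, ∑ z : Fin H → Z, F fun t => (x t, z t) := by
  rw [← Fintype.sum_prod_type']
  exact Fintype.sum_equiv (Equiv.arrowProdEquivProdArrow (Fin H) _ _) _ _ fun _ => rfl

lemma bddAbove_eventProb {S A Z : Type*} [Fintype S] [Fintype A] [Fintype Z]
    [DecidableEq S] [DecidableEq A] (H : ℕ) {T : S × A → S → ℝ} {ν : S → ℝ}
    (hT : ∀ x, IsDist (T x)) (hν : IsDist ν) {M : ℕ} {w : Fin M → ℝ}
    {μ : Fin M → S × A → Z → ℝ} (hw : IsDist w) (hμ : IsRewardModel μ)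
    (E : Finset (Fin H → S × A)) :
    BddAbove (Set.range fun π : {p : List ((S × A) × Z) → S → A → ℝ // IsPolicy p} =>
      eventProb H T ν π.1 w μ E) := by
  refine ⟨∑ τ : Fin H → (S × A) × Z,
    momentOn w μ (fun t => (τ t).1) (fun t => (τ t).2) Finset.univ, ?_⟩
  rintro _ ⟨π, rfl⟩
  refine Finset.sum_le_sum fun τ _ => ?_
  have hm := momentOn_nonneg hw hμ (fun t => (τ t).1) (fun t => (τ t).2) Finset.univ
  split_ifs
  · rw [trajProb_eq]
    exact mul_le_of_le_one_left hm (pathWeight_le_one H hT hν π.2 τ)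
  · exact hm

/-- The policy that runs `π` with the observed rewards replaced by those of the
reward functions `r`. -/
def fixedRewardPolicy {S A Z : Type*} {H : ℕ} (π : List ((S × A) × Z) → S → A → ℝ)
    (r : Fin H → S × A → Z) (hist : List ((S × A) × Z)) : S → A → ℝ :=
  π (hist.mapIdx fun i p => if h : i < H then (p.1, r ⟨i, h⟩ p.1) else p)

lemma pathWeight_fixedRewardPolicy {S A Z : Type*} {H : ℕ} (T : S × A → S → ℝ) (ν : S → ℝ)
    (π : List ((S × A) × Z) → S → A → ℝ) (r : Fin H → S × A → Z)
    (x : Fin H → S × A) (z : Fin H → Z) :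
    pathWeight H T ν (fixedRewardPolicy π r) (fun t => (x t, z t))
      = pathWeight H T ν π fun t => (x t, r t (x t)) := by
  have hhist (t : Fin H) :
      ((List.ofFn fun t => (x t, z t)).take t.val).mapIdx
        (fun i p => if h : i < H then (p.1, r ⟨i, h⟩ p.1) else p)
      = (List.ofFn fun t => (x t, r t (x t))).take t.val := by
    refine List.ext_getElem (by simp) fun i h₁ h₂ => ?_
    have hi : i < H := by
      simp only [List.length_take, List.length_ofFn] at h₂
      omega
    simp [hi]
  simp only [pathWeight, fixedRewardPolicy, hhist]

lemma sum_pathWeight_le_supEventProb {S A Z : Type*} [Fintype S] [Fintype A] [Fintype Z]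
    [DecidableEq S] [DecidableEq A] (H : ℕ) {T : S × A → S → ℝ} {ν : S → ℝ}
    (hT : ∀ x, IsDist (T x)) (hν : IsDist ν) {M : ℕ} {w : Fin M → ℝ}
    {μ : Fin M → S × A → Z → ℝ} (hw : IsDist w) (hμ : IsRewardModel μ)
    (E : Finset (Fin H → S × A)) {π : List ((S × A) × Z) → S → A → ℝ} (hπ : IsPolicy π)
    (r : Fin H → S × A → Z) :
    ∑ x : Fin H → S × A,
        (if x ∈ E then pathWeight H T ν π (fun t => (x t, r t (x t))) else 0)
      ≤ supEventProb H T ν w μ E := by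
  refine le_trans (le_of_eq ?_) (le_ciSup (bddAbove_eventProb H hT hν hw hμ E)
    ⟨fixedRewardPolicy π r, fun hist s => hπ _ s⟩)
  simp only [eventProb]
  refine Eq.trans ?_ (sum_traj_eq H _).symm
  refine Finset.sum_congr rfl fun x _ => ?_
  split_ifs
  · simp only [trajProb_eq, pathWeight_fixedRewardPolicy]
    rw [← Finset.mul_sum, sum_momentOn_univ hw hμ, mul_one]
  · simp

/-- Lemma: Eventwise Total Variance Discrepancy.
Two RMMDPs with `M` contexts each, sharing `T, ν`.  `n` assigns counts to state-action
sequences of length at most `d = min(2M−1, H)`; `X_l = {x : n(x) ≥ n_l}`, `E_l` is the set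
of length-`H` sequences all of whose subsequences of length `≤ d` lie in `X_l`, and `δ_l`
bounds the mismatch of all moments of well-explored length-`d` sequences.  Then for any
`E' ⊆ E_l` and any history-dependent policy `π`, the statistical distance of trajectories
restricted to `E'` is at most `sup_{π'} P⁽¹⁾_{π'}(x_{1:H} ∈ E') · (4HZ)^{min(2M−1,H)} · δ_l`. -/
theorem statement1 {S A Z : Type*} [Fintype S] [Fintype A] [Fintype Z]
    [DecidableEq S] [DecidableEq A]
    (H : ℕ) (T : S × A → S → ℝ) (ν : S → ℝ)
    (hT : ∀ x, IsDist (T x)) (hν : IsDist ν)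
    {M : ℕ}
    (w₁ : Fin M → ℝ) (μ₁ : Fin M → S × A → Z → ℝ)
    (w₂ : Fin M → ℝ) (μ₂ : Fin M → S × A → Z → ℝ)
    (hw₁ : IsDist w₁) (hw₂ : IsDist w₂)
    (hμ₁ : IsRewardModel μ₁) (hμ₂ : IsRewardModel μ₂)
    (d : ℕ) (hd : d = min (2 * M - 1) H)
    (n : List (S × A) → ℝ) (n_l : ℝ) (hn_l : 0 < n_l)
    (δ_l : ℝ)
    (hδ_l : ∀ x : Fin d → S × A, n_l ≤ n (List.ofFn x) →
      ∀ (z : Fin d → Z) (I : Finset (Fin d)),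
        |momentOn w₁ μ₁ x z I - momentOn w₂ μ₂ x z I| ≤ δ_l)
    (E' : Finset (Fin H → S × A))
    (hE' : ∀ x ∈ E', ∀ xs : List (S × A), xs.length ≤ d →
      xs.Sublist (List.ofFn x) → n_l ≤ n xs)
    (π : List ((S × A) × Z) → S → A → ℝ) (hπ : IsPolicy π) :
    ∑ τ : Fin H → (S × A) × Z,
        (if (fun t => (τ t).1) ∈ E' then
          |trajProb H T ν π w₁ μ₁ τ - trajProb H T ν π w₂ μ₂ τ| else 0)
      ≤ supEventProb H T ν w₁ μ₁ E' * (4 * H * Fintype.card Z : ℝ) ^ (min (2 * M - 1) H)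
          * δ_l := by
  have hS : Nonempty S := by
    by_contra h
    rw [not_nonempty_iff] at h
    simpa using hν.2
  obtain ⟨s₀⟩ := hS
  have hA : Nonempty A := by
    by_contra h
    rw [not_nonempty_iff] at h
    simpa using (hπ [] s₀).2
  obtain ⟨a₀⟩ := hA
  have hM : 0 < M := by
    by_contra h
    obtain rfl : M = 0 := by omega
    simpa using hw₁.2
  have hZ : Nonempty Z := by
    by_contra h
    rw [not_nonempty_iff] at h
    simpa using (hμ₁ ⟨0, hM⟩ (s₀, a₀)).2
  rcases E'.eq_empty_or_nonempty with rfl | ⟨x₀, hx₀⟩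
  · simp [supEventProb, eventProb]
  set C := differenceComponents w₁ μ₁ w₂ μ₂ with hC
  have hlen : C.length = 2 * M := by simp [hC, differenceComponents, two_mul]
  have hbound (τ : Fin H → (S × A) × Z) (hτ : (fun t => (τ t).1) ∈ E')
      (l : List ((S × A) × Z)) (hl : l.Sublist (List.ofFn τ)) (hlC : l.length < C.length) :
      |signedMoment C l| ≤ δ_l := by
    have hlH : l.length ≤ H := by simpa using hl.length_le
    obtain ⟨l', hll', hl'τ, hl'd⟩ := exists_sublist_between hl d (by omega) (by simp; omega)
    obtain ⟨y, rfl⟩ : ∃ y : Fin d → (S × A) × Z, l' = List.ofFn y := by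
      subst hl'd
      exact ⟨l'.get, (List.ofFn_get l').symm⟩
    obtain ⟨I, hI⟩ := exists_finset_prod_of_sublist hll'
    rw [hC, signedMoment_differenceComponents w₁ μ₁ w₂ μ₂ l (fun i => (y i).1)
      (fun i => (y i).2) I hI]
    refine hδ_l _ (hE' _ hτ _ (by simp) ?_) _ _
    simpa [List.map_ofFn, Function.comp_def] using hl'τ.map Prod.fst
  have hmoment (τ : Fin H → (S × A) × Z) :
      signedMoment C (List.ofFn τ)
        = momentOn w₁ μ₁ (fun t => (τ t).1) (fun t => (τ t).2) Finset.univ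
          - momentOn w₂ μ₂ (fun t => (τ t).1) (fun t => (τ t).2) Finset.univ :=
    signedMoment_differenceComponents w₁ μ₁ w₂ μ₂ _ _ _ _ fun f => by
      simp [List.map_ofFn, List.prod_ofFn]
  have hδ₀ : 0 ≤ δ_l := by
    obtain ⟨z₀⟩ := hZ
    exact (abs_nonneg _).trans
      (hbound (fun t => (x₀ t, z₀)) hx₀ [] (List.nil_sublist _) (by simp [hlen, hM]))
  have hdist := fun e (he : e ∈ C) => mem_differenceComponents hμ₁ hμ₂ he
  have hpoint (τ : Fin H → (S × A) × Z) :
      (if (fun t => (τ t).1) ∈ E' then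
          |trajProb H T ν π w₁ μ₁ τ - trajProb H T ν π w₂ μ₂ τ| else 0)
        ≤ δ_l * ((if (fun t => (τ t).1) ∈ E' then pathWeight H T ν π τ else 0)
          * mixtureMajorant (C.map Prod.snd) (List.ofFn τ)) := by
    split_ifs with hτ
    · have hp := pathWeight_nonneg H hT hν hπ τ
      rw [trajProb_eq, trajProb_eq, ← mul_sub, abs_mul, abs_of_nonneg hp, ← hmoment,
        mul_left_comm]
      refine mul_le_mul_of_nonneg_left (abs_signedMoment_le _ C ?_ _ (hbound τ hτ)) hp
      exact fun e he x z =>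
        ⟨(hdist e he x).1 z, le_one_of_sum_eq_one (hdist e he x).1 (hdist e he x).2 z⟩
    · simp
  have hsup := sum_pathWeight_le_supEventProb H hT hν hw₁ hμ₁ E' hπ
  have hsup₀ : 0 ≤ supEventProb H T ν w₁ μ₁ E' := by
    obtain ⟨z₀⟩ := hZ
    refine le_trans (Finset.sum_nonneg fun x _ => ?_) (hsup fun _ _ => z₀)
    split_ifs
    · exact pathWeight_nonneg H hT hν hπ _
    · exact le_rfl
  have hmass := sum_mul_mixtureMajorant_le H (C.map Prod.snd)
    (by
      intro f hf
      obtain ⟨e, he, rfl⟩ := List.mem_map.1 hf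
      exact hdist e he)
    (fun τ => if (fun t => (τ t).1) ∈ E' then pathWeight H T ν π τ else 0) _ hsup
  have hcard : (1 : ℝ) ≤ Fintype.card Z := by exact_mod_cast Fintype.card_pos
  have hb := majorantMass_le (2 * Fintype.card Z) (by linarith) H (2 * M - 1)
  rw [show 2 * M - 1 + 1 = 2 * M by omega,
    show (2 * H * (2 * Fintype.card Z) : ℝ) = 4 * H * Fintype.card Z by ring] at hb
  rw [List.length_map, hlen] at hmass
  calc _ ≤ _ := Finset.sum_le_sum fun τ _ => hpoint τ
    _ ≤ δ_l * (majorantMass (2 * Fintype.card Z) (2 * M) H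
          * supEventProb H T ν w₁ μ₁ E') := by
        rw [← Finset.mul_sum]
        exact mul_le_mul_of_nonneg_left hmass hδ₀
    _ ≤ δ_l * ((4 * H * Fintype.card Z : ℝ) ^ (min (2 * M - 1) H)
          * supEventProb H T ν w₁ μ₁ E') := by gcongr
    _ = _ := by ring
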